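/- Suppose q > 1 belongs to the closure of the set U of univoque numbers but not to U itself. Then every x ∈ V_q ∖ U_q has countably infinitely many expansions in base q, i.e., the set of sequences (c_i) of integers with 0 ≤ c_i ≤ ⌈q⌉ − 1 and ∑_{i=1}^∞ c_i q^{−i} = x is countably infinite. -/

import Mathlib

open Classical

noncomputable section

/-- The largest digit in base `q`: `α₁ = ⌈q⌉ - 1`. -/
def alphaOne (q : ℝ) : ℕ := (⌈q⌉ - 1).toNat

/-- `c` (0-indexed: `c i` is the digit `c_{i+1}` of the paper) is an expansion of `x`
in base `q`: all digits lie in `{0, …, α₁}` and `x = ∑_{i≥1} c_i q^{-i}`. -/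
def IsExpansionOf (q x : ℝ) (c : ℕ → ℕ) : Prop :=
  (∀ i, c i ≤ alphaOne q) ∧ x = ∑' i, (c i : ℝ) / q ^ (i + 1)

/-- A sequence is called infinite if it has infinitely many nonzero terms. -/
def InfiniteSeq (c : ℕ → ℕ) : Prop := {i | c i ≠ 0}.Infinite

/-- Strict lexicographic order on sequences. -/
def LexLt (a b : ℕ → ℕ) : Prop := ∃ n, (∀ i, i < n → a i = b i) ∧ a n < b n

/-- Lexicographic order `≤` on sequences. -/
def LexLe (a b : ℕ → ℕ) : Prop := LexLt a b ∨ a = b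

/-- `b` is the greedy (lexicographically largest) expansion of `x` in base `q`. -/
def IsGreedyOf (q x : ℝ) (b : ℕ → ℕ) : Prop :=
  IsExpansionOf q x b ∧ ∀ c, IsExpansionOf q x c → LexLe c b

/-- `a` is the quasi-greedy (lexicographically largest infinite) expansion of `x`
in base `q`. -/
def IsQuasiGreedyOf (q x : ℝ) (a : ℕ → ℕ) : Prop :=
  IsExpansionOf q x a ∧ InfiniteSeq a ∧
    ∀ c, IsExpansionOf q x c → InfiniteSeq c → LexLe c a

/-- The quasi-greedy expansion of `x` in base `q`; by convention it is the zero
sequence whenever no infinite expansion exists (in particular for `x = 0`). -/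
def quasiGreedy (q x : ℝ) : ℕ → ℕ :=
  if h : ∃ a, IsQuasiGreedyOf q x a then h.choose else fun _ => 0

/-- The greedy expansion of `x` in base `q` (zero sequence if `x` has no expansion). -/
def greedy (q x : ℝ) : ℕ → ℕ :=
  if h : ∃ b, IsGreedyOf q x b then h.choose else fun _ => 0

/-- The interval `J_q = [0, α₁/(q-1)]`. -/
def Jq (q : ℝ) : Set ℝ := Set.Icc 0 ((alphaOne q : ℝ) / (q - 1))

/-- `U_q`: the set of real numbers having exactly one expansion in base `q`. -/
def Uq (q : ℝ) : Set ℝ := {x | ∃! c, IsExpansionOf q x c}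

/-- `U_q'`: the set of univoque sequences in base `q`. -/
def UqSeq (q : ℝ) : Set (ℕ → ℕ) := {c | ∃ x ∈ Uq q, IsExpansionOf q x c}

/-- `U`: the set of univoque numbers. -/
def USet : Set ℝ := {q | 1 < q ∧ ∃! c, IsExpansionOf q 1 c}

/-- `V_q`: the set of `x ∈ J_q` such that for every `n ≥ 1` with `a_n(x) > 0` the
conjugated shifted quasi-greedy expansion is lexicographically at most `(α_i)`. -/
def Vq (q : ℝ) : Set ℝ :=
  {x | x ∈ Jq q ∧ ∀ n, 0 < quasiGreedy q x n →
    LexLe (fun i => alphaOne q - quasiGreedy q x (n + 1 + i)) (quasiGreedy q 1)}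

/-- `V`: the set of `q > 1` whose quasi-greedy expansion `(α_i)` of `1` satisfies
`(α₁ - α_{k+i})_{i≥1} ≤ (α_i)_{i≥1}` lexicographically for all `k ≥ 1`. -/
def VSet : Set ℝ :=
  {q | 1 < q ∧ ∀ k, LexLe (fun i => alphaOne q - quasiGreedy q 1 (k + 1 + i)) (quasiGreedy q 1)}

/-- The value in base `q` of the tail of `c` starting at index `n`. -/
def tailValue (q : ℝ) (c : ℕ → ℕ) (n : ℕ) : ℝ := ∑' i, (c (n + i) : ℝ) / q ^ (i + 1)

/-- All terms of `c` are digits in base `q`. -/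
def DigitSeq (q : ℝ) (c : ℕ → ℕ) : Prop := ∀ i, c i ≤ alphaOne q

/-- The conjugate sequence. -/
def conjSeq (q : ℝ) (c : ℕ → ℕ) : ℕ → ℕ := fun i => alphaOne q - c i

/-- The finite sequence obtained from `a` by increasing the digit with index `n` and
deleting all later digits. -/
def bumpSeq (a : ℕ → ℕ) (n : ℕ) : ℕ → ℕ :=
  fun i => if i < n then a i else if i = n then a i + 1 else 0

/-- The tail-value characterization of quasi-greedy sequences. -/
structure QuasiGreedySeq (q : ℝ) (a : ℕ → ℕ) : Prop where
  digit : DigitSeq q a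
  pos : ∀ n, 0 < tailValue q a n
  le_one : ∀ n, a n < alphaOne q → tailValue q a (n + 1) ≤ 1

/-- After a digit of `a` which is not maximal the tail has value at most `1`, and the value `1` is
only attained by the tail `α`. -/
def TailsBounded (q : ℝ) (α a : ℕ → ℕ) : Prop :=
  ∀ n, a n < alphaOne q →
    tailValue q a (n + 1) ≤ 1 ∧ (tailValue q a (n + 1) = 1 → ∀ i, a (n + 1 + i) = α i)

theorem le_alphaOne_add_one {q : ℝ} (hq : 1 < q) : q ≤ (alphaOne q : ℝ) + 1 := by
  have h1 : (1 : ℤ) < ⌈q⌉ := Int.lt_ceil.mpr (by exact_mod_cast hq)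
  have h2 : ((alphaOne q : ℕ) : ℤ) = ⌈q⌉ - 1 := Int.toNat_of_nonneg (by omega)
  have h3 : ((alphaOne q : ℕ) : ℝ) = (⌈q⌉ : ℝ) - 1 := by exact_mod_cast h2
  rw [h3]
  linarith [Int.le_ceil q]

theorem one_le_max {q : ℝ} (hq : 1 < q) : 1 ≤ (alphaOne q : ℝ) / (q - 1) := by
  rw [le_div_iff₀ (by linarith)]
  linarith [le_alphaOne_add_one hq]

theorem isExpansionOf_iff {q x : ℝ} {c : ℕ → ℕ} :
    IsExpansionOf q x c ↔ DigitSeq q c ∧ x = tailValue q c 0 := by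
  simp [IsExpansionOf, DigitSeq, tailValue]

theorem summable_digits {q : ℝ} (hq : 1 < q) {c : ℕ → ℕ} (hc : DigitSeq q c) (n : ℕ) :
    Summable fun i => (c (n + i) : ℝ) / q ^ (i + 1) := by
  have hg : Summable fun i : ℕ => (alphaOne q : ℝ) * q⁻¹ ^ (i + 1) :=
    ((summable_nat_add_iff 1).mpr (summable_geometric_of_lt_one (by positivity)
      (inv_lt_one_of_one_lt₀ hq))).mul_left _
  refine Summable.of_nonneg_of_le (fun i => by positivity) (fun i => ?_) hg
  rw [inv_pow, div_eq_mul_inv]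
  have : (c (n + i) : ℝ) ≤ alphaOne q := by exact_mod_cast hc _
  gcongr

theorem tailValue_nonneg {q : ℝ} (hq : 1 < q) (c : ℕ → ℕ) (n : ℕ) : 0 ≤ tailValue q c n :=
  tsum_nonneg fun i => by positivity

theorem tailValue_rec {q : ℝ} (hq : 1 < q) {c : ℕ → ℕ} (hc : DigitSeq q c) (n : ℕ) :
    tailValue q c (n + 1) = q * tailValue q c n - c n := by
  have h := (summable_digits hq hc n).tsum_eq_zero_add
  have h2 : ∑' i, (c (n + (i + 1)) : ℝ) / q ^ (i + 1 + 1) = tailValue q c (n + 1) / q := by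
    rw [tailValue, ← tsum_div_const]
    refine tsum_congr fun i => ?_
    rw [show n + (i + 1) = n + 1 + i by ring, pow_succ q (i + 1), div_div]
  have hq0 : q ≠ 0 := by positivity
  rw [h2] at h
  rw [show tailValue q c n = _ from h]
  simp
  field_simp
  ring

theorem tailValue_le {q : ℝ} (hq : 1 < q) {c : ℕ → ℕ} (hc : DigitSeq q c) (n : ℕ) :
    tailValue q c n ≤ (alphaOne q : ℝ) / (q - 1) := by
  have hg := ((hasSum_geometric_of_lt_one (r := q⁻¹) (by positivity)
      (inv_lt_one_of_one_lt₀ hq)).mul_left (q⁻¹ * (alphaOne q : ℝ)))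
  have e : q⁻¹ * (alphaOne q : ℝ) * (1 - q⁻¹)⁻¹ = (alphaOne q : ℝ) / (q - 1) := by
    have : q - 1 ≠ 0 := by linarith
    have h0 : q ≠ 0 := by positivity
    have h1 : 1 - q⁻¹ ≠ 0 := by
      have := inv_lt_one_of_one_lt₀ hq
      linarith
    field_simp
  rw [← e]
  refine hasSum_le (fun i => ?_) (summable_digits hq hc n).hasSum hg
  have : (c (n + i) : ℝ) ≤ alphaOne q := by exact_mod_cast hc _
  rw [inv_pow, pow_succ, div_eq_mul_inv, mul_inv]
  calc (c (n + i) : ℝ) * ((q ^ i)⁻¹ * q⁻¹) ≤ alphaOne q * ((q ^ i)⁻¹ * q⁻¹) := by gcongr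
    _ = _ := by ring

theorem eq_zero_of_bounded {q M : ℝ} (hq : 1 < q) {d : ℕ → ℝ} (hM : ∀ n, |d n| ≤ M)
    (hd : ∀ n, d (n + 1) = q * d n) (n : ℕ) : d n = 0 := by
  by_contra hne
  have hk : ∀ k, d (n + k) = q ^ k * d n := by
    intro k
    induction k with
    | zero => simp
    | succ k ih => rw [← add_assoc, hd, ih]; ring
  have hpos : 0 < |d n| := abs_pos.mpr hne
  obtain ⟨k, h⟩ := pow_unbounded_of_one_lt (M / |d n|) hq
  have := hM (n + k)
  rw [hk, abs_mul, abs_of_nonneg (by positivity)] at this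
  rw [div_lt_iff₀ hpos] at h
  linarith

/-- The tail values are the only bounded solution of the digit recursion. -/
theorem eq_tailValue {q M : ℝ} (hq : 1 < q) {c : ℕ → ℕ} (hc : DigitSeq q c) {r : ℕ → ℝ}
    (hM : ∀ n, |r n| ≤ M) (hr : ∀ n, r (n + 1) = q * r n - c n) (n : ℕ) :
    r n = tailValue q c n := by
  have := eq_zero_of_bounded (M := M + (alphaOne q : ℝ) / (q - 1)) (d := fun n =>
    r n - tailValue q c n) hq (fun n => ?_) (fun n => ?_) n
  · simpa [sub_eq_zero] using this
  · refine (abs_sub _ _).trans ?_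
    rw [abs_of_nonneg (tailValue_nonneg hq c n)]
    exact add_le_add (hM n) (tailValue_le hq hc n)
  · simp only [hr, tailValue_rec hq hc]
    ring

theorem DigitSeq.conj (q : ℝ) (c : ℕ → ℕ) : DigitSeq q (conjSeq q c) :=
  fun _ => Nat.sub_le _ _

theorem DigitSeq.conj_conj {q : ℝ} {c : ℕ → ℕ} (hc : DigitSeq q c) :
    conjSeq q (conjSeq q c) = c := by
  funext i
  have := hc i
  simp only [conjSeq]
  omega

theorem tailValue_conj {q : ℝ} (hq : 1 < q) {c : ℕ → ℕ} (hc : DigitSeq q c) (n : ℕ) :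
    tailValue q (conjSeq q c) n = (alphaOne q : ℝ) / (q - 1) - tailValue q c n := by
  refine (eq_tailValue (M := (alphaOne q : ℝ) / (q - 1)) hq (DigitSeq.conj q c)
    (r := fun n => (alphaOne q : ℝ) / (q - 1) - tailValue q c n)
    (fun n => ?_) (fun n => ?_) n).symm
  · have h1 := tailValue_le hq hc n
    have h2 := tailValue_nonneg hq c n
    rw [abs_of_nonneg (by linarith)]
    linarith
  · have : q - 1 ≠ 0 := by linarith
    simp only [conjSeq, tailValue_rec hq hc]
    rw [Nat.cast_sub (hc n)]
    field_simp
    ring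

theorem eq_zero_of_tailValue {q : ℝ} (hq : 1 < q) {c : ℕ → ℕ} (hc : DigitSeq q c) {n : ℕ}
    (h : tailValue q c n = 0) (i : ℕ) : c (n + i) = 0 := by
  have h0 := (summable_digits hq hc n).hasSum
  rw [show ∑' i, (c (n + i) : ℝ) / q ^ (i + 1) = 0 from h,
    hasSum_zero_iff_of_nonneg (fun i => by positivity)] at h0
  have h1 := congrFun h0 i
  have : q ^ (i + 1) ≠ 0 := by positivity
  simpa [this] using h1

/-- If two sequences agree on `m` digits, their values differ by the scaled difference of tails. -/
theorem tailValue_sub {q : ℝ} (hq : 1 < q) {b c : ℕ → ℕ} (hb : DigitSeq q b) (hc : DigitSeq q c)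
    {n k m : ℕ} (h : ∀ i < m, b (n + i) = c (k + i)) :
    tailValue q b (n + m) - tailValue q c (k + m) =
      q ^ m * (tailValue q b n - tailValue q c k) := by
  induction m with
  | zero => simp
  | succ m ih =>
    rw [← add_assoc, ← add_assoc, tailValue_rec hq hb, tailValue_rec hq hc, h m (by omega)]
    have := ih fun i hi => h i (by omega)
    rw [pow_succ]
    linear_combination q * this

theorem tailValue_eq_of_eq {q : ℝ} {b c : ℕ → ℕ} {n k : ℕ} (h : ∀ i, b (n + i) = c (k + i)) :
    tailValue q b n = tailValue q c k := by
  simp [tailValue, h]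

theorem exists_first_ne {c a : ℕ → ℕ} (h : c ≠ a) :
    ∃ n, (∀ i < n, c i = a i) ∧ c n ≠ a n := by
  have h' : ∃ n, c n ≠ a n := Function.ne_iff.mp h
  exact ⟨Nat.find h', fun i hi => not_not.mp (Nat.find_min h' hi), Nat.find_spec h'⟩

theorem tailValue_eq_of_prefix {q : ℝ} (hq : 1 < q) {c a : ℕ → ℕ} (hc : DigitSeq q c)
    (ha : DigitSeq q a) (hv : tailValue q c 0 = tailValue q a 0) {n : ℕ}
    (h : ∀ i < n, c i = a i) :
    tailValue q c (n + 1) = tailValue q a (n + 1) - ((c n : ℝ) - a n) := by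
  have := tailValue_sub hq hc ha (n := 0) (k := 0) (m := n) (by simpa using h)
  simp only [zero_add, hv, sub_self, mul_zero] at this
  rw [tailValue_rec hq hc, tailValue_rec hq ha]
  linear_combination q * this

theorem QuasiGreedySeq.exists_of_mem {q x : ℝ} (hq : 1 < q) (hx0 : 0 < x)
    (hx : x ≤ (alphaOne q : ℝ) / (q - 1)) :
    ∃ a, QuasiGreedySeq q a ∧ tailValue q a 0 = x := by
  let L : ℝ := (alphaOne q : ℝ) / (q - 1)
  let digit : ℝ → ℕ := fun r => min (alphaOne q) (⌈q * r⌉₊ - 1)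
  let r : ℕ → ℝ := fun n => Nat.rec x (fun _ r => q * r - digit r) n
  have hr : ∀ n, r (n + 1) = q * r n - digit (r n) := fun _ => rfl
  have hL : q * L - alphaOne q = L := by
    have : q - 1 ≠ 0 := by linarith
    simp only [L]
    field_simp
    ring
  have hL1 : 1 ≤ L := one_le_max hq
  have key : ∀ s, 0 < s → 0 < q * s - digit s ∧ (digit s < alphaOne q → q * s - digit s ≤ 1) := by
    intro s hs
    have hqs : 0 < q * s := by positivity
    have hc1 : 0 < ⌈q * s⌉₊ := Nat.ceil_pos.mpr hqs
    have hc2 : (⌈q * s⌉₊ : ℝ) < q * s + 1 := Nat.ceil_lt_add_one hqs.le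
    have hc3 : q * s ≤ (⌈q * s⌉₊ : ℝ) := Nat.le_ceil _
    have hc4 : ((⌈q * s⌉₊ - 1 : ℕ) : ℝ) = (⌈q * s⌉₊ : ℝ) - 1 := by
      rw [Nat.cast_sub hc1]
      simp
    constructor
    · have : (digit s : ℝ) ≤ ((⌈q * s⌉₊ - 1 : ℕ) : ℝ) := by
        exact_mod_cast min_le_right _ _
      linarith
    · intro h
      have : digit s = ⌈q * s⌉₊ - 1 := by
        simp only [digit] at h ⊢
        omega
      rw [this]
      linarith
  have hmem : ∀ n, 0 < r n ∧ r n ≤ L := by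
    intro n
    induction n with
    | zero => exact ⟨hx0, hx⟩
    | succ n ih =>
      obtain ⟨h1, h2⟩ := key _ ih.1
      rw [hr]
      refine ⟨h1, ?_⟩
      rcases lt_or_eq_of_le (show digit (r n) ≤ alphaOne q from min_le_left _ _) with h | h
      · exact (h2 h).trans hL1
      · rw [h, ← hL]
        have := ih.2
        gcongr
  have hdig : DigitSeq q fun n => digit (r n) := fun n => min_le_left _ _
  have hval : ∀ n, r n = tailValue q (fun n => digit (r n)) n :=
    eq_tailValue (M := L) hq hdig (fun n => by
      rw [abs_of_pos (hmem n).1]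
      exact (hmem n).2) hr
  refine ⟨fun n => digit (r n), ⟨hdig, fun n => ?_, fun n hn => ?_⟩, (hval 0).symm⟩
  · rw [← hval]
    exact (hmem n).1
  · rw [← hval, hr]
    exact (key _ (hmem n).1).2 hn

theorem QuasiGreedySeq.isQuasiGreedyOf {q : ℝ} (hq : 1 < q) {a : ℕ → ℕ}
    (ha : QuasiGreedySeq q a) : IsQuasiGreedyOf q (tailValue q a 0) a := by
  refine ⟨isExpansionOf_iff.mpr ⟨ha.digit, rfl⟩, ?_, fun c hc hinf => ?_⟩
  · refine Set.infinite_of_forall_exists_gt fun n => ?_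
    by_contra hcon
    push Not at hcon
    have h0 : tailValue q a (n + 1) = 0 := by
      have : ∀ i, a (n + 1 + i) = 0 := fun i => by
        by_contra hi
        exact absurd (hcon _ hi) (by omega)
      simp [tailValue, this]
    exact absurd h0 (ha.pos _).ne'
  · obtain ⟨hcd, hcv⟩ := isExpansionOf_iff.mp hc
    by_cases hca : c = a
    · exact Or.inr hca
    obtain ⟨n, hpre, hne⟩ := exists_first_ne hca
    refine Or.inl ⟨n, hpre, lt_of_le_of_ne (not_lt.mp fun hlt => ?_) hne⟩
    have h1 := tailValue_eq_of_prefix hq hcd ha.digit hcv.symm hpre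
    have h2 := ha.le_one n (hlt.trans_le (hcd n))
    have h3 : (a n : ℝ) + 1 ≤ c n := by exact_mod_cast hlt
    have h4 : tailValue q c (n + 1) = 0 :=
      le_antisymm (by linarith) (tailValue_nonneg hq c _)
    refine hinf ((Set.finite_Iio (n + 1)).subset fun i hi => ?_)
    by_contra hlarge
    simp only [Set.mem_Iio, not_lt] at hlarge
    obtain ⟨j, rfl⟩ := Nat.exists_eq_add_of_le hlarge
    exact hi (eq_zero_of_tailValue hq hcd h4 j)

theorem LexLe.antisymm {a b : ℕ → ℕ} (h₁ : LexLe a b) (h₂ : LexLe b a) : a = b := by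
  rcases h₁ with ⟨n, hn, hlt⟩ | h
  · rcases h₂ with ⟨m, hm, hlt'⟩ | h
    · rcases lt_trichotomy n m with h | h | h
      · have := hm n h
        omega
      · subst h
        omega
      · have := hn m h
        omega
    · exact h.symm
  · exact h

theorem quasiGreedySeq_quasiGreedy {q x : ℝ} (hq : 1 < q) (hx0 : 0 < x)
    (hx : x ≤ (alphaOne q : ℝ) / (q - 1)) :
    QuasiGreedySeq q (quasiGreedy q x) ∧ tailValue q (quasiGreedy q x) 0 = x := by
  obtain ⟨a, ha, rfl⟩ := QuasiGreedySeq.exists_of_mem hq hx0 hx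
  have h := ha.isQuasiGreedyOf hq
  have hex : ∃ b, IsQuasiGreedyOf q (tailValue q a 0) b := ⟨a, h⟩
  have : quasiGreedy q (tailValue q a 0) = a := by
    rw [quasiGreedy, dif_pos hex]
    have h' := hex.choose_spec
    exact LexLe.antisymm (h.2.2 _ h'.1 h'.2.1) (h'.2.2 _ h.1 h.2.1)
  rw [this]
  exact ⟨ha, rfl⟩

theorem QuasiGreedySeq.tail_unique {q : ℝ} (hq : 1 < q) {a b : ℕ → ℕ} (ha : QuasiGreedySeq q a)
    (hb : QuasiGreedySeq q b) {m : ℕ} (h : tailValue q a m = tailValue q b 0) (i : ℕ) :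
    a (m + i) = b i := by
  induction i using Nat.strong_induction_on with
  | _ i ih =>
    have h1 := tailValue_sub hq ha.digit hb.digit (n := m) (k := 0) (m := i) (by simpa using ih)
    rw [h, sub_self, mul_zero, zero_add] at h1
    have h2 := tailValue_rec hq ha.digit (m + i)
    have h3 := tailValue_rec hq hb.digit i
    rcases lt_trichotomy (a (m + i)) (b i) with hlt | heq | hlt
    · have h4 := ha.le_one _ (hlt.trans_le (hb.digit i))
      have h5 := hb.pos (i + 1)
      have h6 : (a (m + i) : ℝ) + 1 ≤ b i := by exact_mod_cast hlt
      have h7 : q * (tailValue q a (m + i) - tailValue q b i) = 0 := by rw [h1, mul_zero]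
      linarith
    · exact heq
    · have h4 := hb.le_one _ (hlt.trans_le (ha.digit _))
      have h5 := ha.pos (m + i + 1)
      have h6 : (b i : ℝ) + 1 ≤ a (m + i) := by exact_mod_cast hlt
      have h7 : q * (tailValue q a (m + i) - tailValue q b i) = 0 := by rw [h1, mul_zero]
      linarith

theorem QuasiGreedySeq.tailsBounded {q : ℝ} (hq : 1 < q) {a α : ℕ → ℕ} (ha : QuasiGreedySeq q a)
    (hα : QuasiGreedySeq q α) (hα1 : tailValue q α 0 = 1) : TailsBounded q α a :=
  fun n hn => ⟨ha.le_one n hn, fun h => ha.tail_unique hq hα (h.trans hα1.symm)⟩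

/-- A lexicographic bound on the tails yields a bound on their values. -/
theorem tailsBounded_of_lexLe {q : ℝ} (hq : 1 < q) {b α : ℕ → ℕ} (hb : DigitSeq q b)
    (hα : QuasiGreedySeq q α) (hα1 : tailValue q α 0 = 1)
    (h : ∀ n, b n < alphaOne q → LexLe (fun i => b (n + 1 + i)) α) : TailsBounded q α b := by
  have step : ∀ n m, (∀ i < m, b (n + 1 + i) = α i) → b (n + 1 + m) < α m →
      q ^ (m + 1) * (tailValue q b (n + 1) - 1) < tailValue q b (n + 1 + m + 1) - 1 := by
    intro n m hpre hlt
    have h1 := tailValue_sub hq hb hα.digit (n := n + 1) (k := 0) (m := m) (by simpa using hpre)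
    rw [hα1, zero_add] at h1
    have h2 := tailValue_rec hq hb (n + 1 + m)
    have h3 := tailValue_rec hq hα.digit m
    have h4 := hα.pos (m + 1)
    have h5 : (b (n + 1 + m) : ℝ) + 1 ≤ α m := by exact_mod_cast hlt
    have h6 : q ^ (m + 1) * (tailValue q b (n + 1) - 1) =
        q * (tailValue q b (n + 1 + m) - tailValue q α m) := by
      rw [h1]
      ring
    rw [h6]
    linarith
  have bound : ∀ k n, b n < alphaOne q →
      tailValue q b (n + 1) - 1 ≤ (alphaOne q : ℝ) / (q - 1) / q ^ k := by
    intro k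
    induction k with
    | zero =>
      intro n _
      have := tailValue_le hq hb (n + 1)
      simp
      linarith
    | succ k ih =>
      intro n hn
      have hL : 0 ≤ (alphaOne q : ℝ) / (q - 1) := zero_le_one.trans (one_le_max hq)
      rcases h n hn with ⟨m, hpre, hlt⟩ | heq
      · have h1 := step n m hpre hlt
        have h2 := ih _ (hlt.trans_le (hα.digit m))
        by_contra! hcon
        have h3 : 0 ≤ (alphaOne q : ℝ) / (q - 1) / q ^ (k + 1) := by positivity
        have h4 : q ≤ q ^ (m + 1) := le_self_pow₀ hq.le (by omega)
        have h5 : (alphaOne q : ℝ) / (q - 1) / q ^ k =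
            q * ((alphaOne q : ℝ) / (q - 1) / q ^ (k + 1)) := by
          have hq0 : q ≠ 0 := by positivity
          have : q - 1 ≠ 0 := by linarith
          rw [pow_succ]
          field_simp
        have h6 : q * (tailValue q b (n + 1) - 1) ≤
            q ^ (m + 1) * (tailValue q b (n + 1) - 1) := by
          gcongr
          linarith
        have h7 : q * ((alphaOne q : ℝ) / (q - 1) / q ^ (k + 1)) <
            q * (tailValue q b (n + 1) - 1) := by gcongr
        linarith
      · have h1 : tailValue q b (n + 1) = tailValue q α 0 :=
          tailValue_eq_of_eq fun i => by simpa using congrFun heq i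
        rw [h1, hα1, sub_self]
        positivity
  have le_one : ∀ n, b n < alphaOne q → tailValue q b (n + 1) ≤ 1 := by
    intro n hn
    have hlim : Filter.Tendsto (fun k : ℕ => (alphaOne q : ℝ) / (q - 1) / q ^ k)
        Filter.atTop (nhds 0) :=
      tendsto_const_nhds.div_atTop (tendsto_pow_atTop_atTop_of_one_lt hq)
    linarith [ge_of_tendsto' hlim fun k => bound k n hn]
  intro n hn
  refine ⟨le_one n hn, fun heq => ?_⟩
  rcases h n hn with ⟨m, hpre, hlt⟩ | h'
  · have h1 := step n m hpre hlt
    have h2 := le_one _ (hlt.trans_le (hα.digit m))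
    rw [heq, sub_self, mul_zero] at h1
    linarith
  · exact congrFun h'

theorem eq_bumpSeq {q : ℝ} (hq : 1 < q) {c a : ℕ → ℕ} (hc : DigitSeq q c) (ha : DigitSeq q a)
    {α : ℕ → ℕ} (hb : TailsBounded q α a) (hv : tailValue q c 0 = tailValue q a 0) {n : ℕ}
    (hpre : ∀ i < n, c i = a i) (hlt : a n < c n) :
    a n < alphaOne q ∧ (∀ i, a (n + 1 + i) = α i) ∧ c = bumpSeq a n := by
  have hn := hlt.trans_le (hc n)
  obtain ⟨h1, h2⟩ := hb n hn
  have h3 := tailValue_eq_of_prefix hq hc ha hv hpre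
  have h4 : (a n : ℝ) + 1 ≤ c n := by exact_mod_cast hlt
  have h5 := tailValue_nonneg hq c (n + 1)
  have h6 : (c n : ℝ) = a n + 1 := le_antisymm (by linarith) h4
  refine ⟨hn, h2 (by linarith), ?_⟩
  have h7 : tailValue q c (n + 1) = 0 := le_antisymm (by linarith) h5
  funext i
  rcases lt_trichotomy i n with h | h | h
  · simp [bumpSeq, h, hpre i h]
  · subst h
    simp only [bumpSeq, lt_irrefl, if_true, if_false]
    exact_mod_cast h6
  · obtain ⟨j, rfl⟩ := Nat.exists_eq_add_of_le (Nat.succ_le_of_lt h)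
    rw [eq_zero_of_tailValue hq hc h7]
    simp [bumpSeq, show ¬ n + 1 + j < n by omega, show n + 1 + j ≠ n by omega]

/-- All expansions other than `a` arise by bumping a digit of `a` or of its conjugate. -/
theorem expansion_cases {q : ℝ} (hq : 1 < q) {c a : ℕ → ℕ} (hc : DigitSeq q c)
    (ha : DigitSeq q a) {α : ℕ → ℕ} (hb : TailsBounded q α a)
    (hb' : TailsBounded q α (conjSeq q a)) (hv : tailValue q c 0 = tailValue q a 0)
    (hne : c ≠ a) :
    (∃ n, a n < alphaOne q ∧ (∀ i, a (n + 1 + i) = α i) ∧ c = bumpSeq a n) ∨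
    ∃ n, conjSeq q a n < alphaOne q ∧ (∀ i, conjSeq q a (n + 1 + i) = α i) ∧
      c = conjSeq q (bumpSeq (conjSeq q a) n) := by
  obtain ⟨n, hpre, hn⟩ := exists_first_ne hne
  rcases lt_or_gt_of_ne hn with hlt | hlt
  · right
    obtain ⟨h1, h2, h3⟩ := eq_bumpSeq (n := n) hq (DigitSeq.conj q c) (DigitSeq.conj q a) hb'
      (by rw [tailValue_conj hq hc, tailValue_conj hq ha, hv])
      (fun i hi => by simp [conjSeq, hpre i hi])
      (by have := ha n; simp only [conjSeq]; omega)
    exact ⟨n, h1, h2, by rw [← h3, hc.conj_conj]⟩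
  · exact Or.inl ⟨n, eq_bumpSeq hq hc ha hb hv hpre hlt⟩

theorem TailsBounded.shift {q : ℝ} {α a b : ℕ → ℕ} {m : ℕ} (h : TailsBounded q α a)
    (hab : ∀ i, a (m + i) = b i) : TailsBounded q α b := by
  intro n hn
  have := h (m + n) (by rwa [hab])
  have e : tailValue q a (m + n + 1) = tailValue q b (n + 1) :=
    tailValue_eq_of_eq fun i => by rw [← hab]; congr 1; omega
  rw [e] at this
  refine ⟨this.1, fun h1 i => ?_⟩
  rw [← this.2 h1 i, ← hab]
  congr 1
  omega

theorem conjSeq_shift {q : ℝ} {a b : ℕ → ℕ} {m : ℕ} (hab : ∀ i, a (m + i) = b i) (i : ℕ) :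
    conjSeq q a (m + i) = conjSeq q b i := by
  simp [conjSeq, hab]

/-- If `1` has several expansions, a doubly bounded `α` is periodic. -/
theorem exists_period {q : ℝ} (hq : 1 < q) {α : ℕ → ℕ} (hα : QuasiGreedySeq q α)
    (hα1 : tailValue q α 0 = 1) (hU : q ∉ USet) (hb : TailsBounded q α α)
    (hb' : TailsBounded q α (conjSeq q α)) :
    ∃ p, α p < alphaOne q ∧ ∀ i, α (p + 1 + i) = α i := by
  obtain ⟨c, hc, hne⟩ : ∃ c, IsExpansionOf q 1 c ∧ c ≠ α := by
    by_contra! hcon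
    exact hU ⟨hq, α, isExpansionOf_iff.mpr ⟨hα.digit, hα1.symm⟩, hcon⟩
  obtain ⟨hcd, hcv⟩ := isExpansionOf_iff.mp hc
  rcases expansion_cases hq hcd hα.digit hb hb' (hcv.symm.trans hα1.symm) hne with
    ⟨n, h1, h2, -⟩ | ⟨n, h1, h2, -⟩
  · exact ⟨n, h1, h2⟩
  · have h3 : ∀ i, α (n + 1 + i) = alphaOne q - α i := fun i => by
      have h4 := h2 i
      have h5 := hα.digit (n + 1 + i)
      simp only [conjSeq] at h4
      omega
    refine ⟨n + 1 + n, by rw [h3]; exact h1, fun i => ?_⟩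
    have h4 := hα.digit i
    rw [show n + 1 + n + 1 + i = n + 1 + (n + 1 + i) by omega, h3, h3]
    omega

theorem bumpSeq_isExpansionOf {q : ℝ} (hq : 1 < q) {a : ℕ → ℕ} (ha : DigitSeq q a) {n : ℕ}
    (hn : a n < alphaOne q) (h1 : tailValue q a (n + 1) = 1) :
    IsExpansionOf q (tailValue q a 0) (bumpSeq a n) := by
  have hd : DigitSeq q (bumpSeq a n) := by
    intro i
    simp only [bumpSeq]
    split_ifs with h h
    · exact ha i
    · subst h
      exact hn
    · exact Nat.zero_le _
  refine isExpansionOf_iff.mpr ⟨hd, ?_⟩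
  have h2 := tailValue_sub hq hd ha (n := 0) (k := 0) (m := n)
    (fun i hi => by simp [bumpSeq, hi])
  have h3 : tailValue q (bumpSeq a n) (n + 1) = 0 := by
    have : ∀ i, bumpSeq a n (n + 1 + i) = 0 := fun i => by
      simp [bumpSeq, show ¬ n + 1 + i < n by omega, show n + 1 + i ≠ n by omega]
    simp [tailValue, this]
  have h4 : (bumpSeq a n n : ℝ) = a n + 1 := by simp [bumpSeq]
  rw [tailValue_rec hq hd, h4] at h3
  rw [tailValue_rec hq ha] at h1
  have h5 : q * (q ^ n * (tailValue q (bumpSeq a n) 0 - tailValue q a 0)) = 0 := by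
    rw [← h2, zero_add]
    linarith
  have hq0 : q ≠ 0 := by positivity
  have h6 : tailValue q (bumpSeq a n) 0 - tailValue q a 0 = 0 := by
    simpa [hq0] using h5
  linarith

theorem infinite_expansions {q : ℝ} (hq : 1 < q) {α a : ℕ → ℕ} (ha : DigitSeq q a)
    (hα1 : tailValue q α 0 = 1) {p n : ℕ} (hp : α p < alphaOne q)
    (hper : ∀ i, α (p + 1 + i) = α i) (hn : a n < alphaOne q)
    (htail : ∀ i, a (n + 1 + i) = α i) :
    {c | IsExpansionOf q (tailValue q a 0) c}.Infinite := by
  have key : ∀ j, a (n + j * (p + 1)) < alphaOne q ∧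
      ∀ i, a (n + j * (p + 1) + 1 + i) = α i := by
    intro j
    induction j with
    | zero => simpa using ⟨hn, htail⟩
    | succ j ih =>
      refine ⟨?_, fun i => ?_⟩
      · rw [show n + (j + 1) * (p + 1) = n + j * (p + 1) + 1 + p by ring, ih.2]
        exact hp
      · rw [show n + (j + 1) * (p + 1) + 1 + i = n + j * (p + 1) + 1 + (p + 1 + i) by ring, ih.2,
          hper]
  refine Set.infinite_of_injective_forall_mem (f := fun j => bumpSeq a (n + j * (p + 1)))
    ?_ fun j => bumpSeq_isExpansionOf hq ha (key j).1 ?_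
  · have hlt : ∀ m k, m < k → bumpSeq a m ≠ bumpSeq a k := by
      intro m k hmk heq
      have := congrFun heq k
      simp [bumpSeq, hmk.ne', hmk.not_gt] at this
    have hinj : Function.Injective (bumpSeq a) := by
      intro m k hmk
      rcases lt_trichotomy m k with h | h | h
      · exact absurd hmk (hlt _ _ h)
      · exact h
      · exact absurd hmk.symm (hlt _ _ h)
    intro i j hij
    simpa using hinj hij
  · rw [← hα1]
    exact tailValue_eq_of_eq fun i => by rw [(key j).2, zero_add]

theorem zero_mem_Uq {q : ℝ} (hq : 1 < q) : (0 : ℝ) ∈ Uq q := by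
  refine ⟨fun _ => 0, ⟨fun _ => Nat.zero_le _, by simp⟩, fun c hc => ?_⟩
  obtain ⟨h1, h2⟩ := isExpansionOf_iff.mp hc
  funext i
  simpa using eq_zero_of_tailValue hq h1 h2.symm i

/-- If `q > 1` lies in the closure of `U` but not in `U`, then every
`x ∈ V_q \ U_q` has countably infinitely many expansions in base `q`. -/
theorem countably_many_expansions (q : ℝ) (hq : 1 < q) (h : q ∈ closure USet)
    (h' : q ∉ USet) (x : ℝ) (hx : x ∈ Vq q \ Uq q) :
    {c | IsExpansionOf q x c}.Countable ∧ {c | IsExpansionOf q x c}.Infinite := by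
  obtain ⟨⟨⟨hx0, hxL⟩, hV⟩, hxU⟩ := hx
  have hxpos : 0 < x := lt_of_le_of_ne hx0 fun h0 => hxU (h0 ▸ zero_mem_Uq hq)
  obtain ⟨hα, hα1⟩ := quasiGreedySeq_quasiGreedy hq zero_lt_one (one_le_max hq)
  obtain ⟨ha, hax⟩ := quasiGreedySeq_quasiGreedy hq hxpos hxL
  generalize quasiGreedy q 1 = α at *
  generalize quasiGreedy q x = a at *
  subst hax
  have hb : TailsBounded q α a := ha.tailsBounded hq hα hα1
  have hb' : TailsBounded q α (conjSeq q a) :=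
    tailsBounded_of_lexLe hq (DigitSeq.conj q a) hα hα1 fun n hn =>
      hV n (by simp only [conjSeq] at hn; omega)
  have hcases : ∀ c, IsExpansionOf q (tailValue q a 0) c → c ≠ a → _ := fun c hc hne =>
    expansion_cases hq (isExpansionOf_iff.mp hc).1 ha.digit hb hb'
      (isExpansionOf_iff.mp hc).2.symm hne
  constructor
  · refine (((Set.countable_singleton a).union (Set.countable_range (bumpSeq a))).union
      (Set.countable_range fun n => conjSeq q (bumpSeq (conjSeq q a) n))).mono fun c hc => ?_
    by_cases hne : c = a
    · exact Or.inl (Or.inl hne)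
    rcases hcases c hc hne with ⟨n, -, -, h⟩ | ⟨n, -, -, h⟩
    · exact Or.inl (Or.inr ⟨n, h.symm⟩)
    · exact Or.inr ⟨n, h.symm⟩
  · obtain ⟨c, hc, hne⟩ : ∃ c, IsExpansionOf q (tailValue q a 0) c ∧ c ≠ a := by
      by_contra! hcon
      exact hxU ⟨a, isExpansionOf_iff.mpr ⟨ha.digit, rfl⟩, hcon⟩
    rcases hcases c hc hne with ⟨n, h1, h2, -⟩ | ⟨n, h1, h2, -⟩
    · obtain ⟨p, hp, hper⟩ := exists_period hq hα hα1 h' (hb.shift h2)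
        (hb'.shift (conjSeq_shift h2))
      exact infinite_expansions hq ha.digit hα1 hp hper h1 h2
    · have h3 := conjSeq_shift (q := q) h2
      rw [ha.digit.conj_conj] at h3
      obtain ⟨p, hp, hper⟩ := exists_period hq hα hα1 h' (hb'.shift h2) (hb.shift h3)
      have hinf := infinite_expansions hq (DigitSeq.conj q a) hα1 hp hper h1 h2
      refine (hinf.image (f := conjSeq q) fun c hc d hd hcd => ?_).mono ?_
      · rw [← DigitSeq.conj_conj hc.1, hcd, DigitSeq.conj_conj hd.1]
      · rintro _ ⟨c, hc, rfl⟩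
        obtain ⟨hcd, hcv⟩ := isExpansionOf_iff.mp hc
        refine isExpansionOf_iff.mpr ⟨DigitSeq.conj q c, ?_⟩
        rw [tailValue_conj hq hcd, ← hcv, tailValue_conj hq ha.digit]
        ring
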